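/- Let V be a nonzero complex vector space with a bijective linear map T : V → V and a linear map P : V → V satisfying P∘T − T∘P = T, such that the only subspaces of V invariant under T, T⁻¹ and P are 0 and V (i.e. V is an irreducible 𝒦-module). Suppose there exist a nonzero vector v ∈ V and a nonzero polynomial q ∈ ℂ[X] with q(T)·v = 0 (V is ℂ[t,t⁻¹]-torsion). Then there exists λ ∈ ℂ, λ ≠ 0, and a linear bijection φ : V → ℂ[x] such that (φ(T u))(x) = λ·(φ u)(x−1) and φ(P u) = x·(φ u) for all u ∈ V; that is, V is isomorphic to Ω(λ) as a 𝒦-module. -/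

import Mathlib

open Polynomial

theorem exists_eigvec {V : Type*} [AddCommGroup V] [Module ℂ V] (T : Module.End ℂ V) :
    ∀ (n : ℕ) (q : Polynomial ℂ) (v : V), q.natDegree = n → q ≠ 0 → v ≠ 0 →
      aeval T q v = 0 → ∃ (l : ℂ) (w : V), w ≠ 0 ∧ T w = l • w := by
  intro n
  induction n with
  | zero =>
    intro q v hn hq hv h
    rw [eq_C_of_natDegree_eq_zero hn] at h hq
    have hc : q.coeff 0 ≠ 0 := fun h0 => hq (by rw [h0, C_0])
    rw [aeval_C, Module.algebraMap_end_apply] at h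
    exact absurd h (smul_ne_zero hc hv)
  | succ n ih =>
    intro q v hn hq hv h
    obtain ⟨l, hl⟩ := IsAlgClosed.exists_root q (by
      rw [degree_eq_natDegree hq, hn]; exact_mod_cast Nat.succ_ne_zero n)
    obtain ⟨r, rfl⟩ := dvd_iff_isRoot.mpr hl
    have hr : r ≠ 0 := right_ne_zero_of_mul hq
    by_cases h0 : aeval T r v = 0
    · refine ih r v ?_ hr hv h0
      rw [natDegree_mul (X_sub_C_ne_zero l) hr, natDegree_X_sub_C] at hn
      omega
    · refine ⟨l, aeval T r v, h0, ?_⟩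
      rw [map_mul, Module.End.mul_apply, map_sub, aeval_X, aeval_C, LinearMap.sub_apply,
        Module.algebraMap_end_apply] at h
      exact sub_eq_zero.mp h

theorem const_of_shift (f : Polynomial ℂ) (h : f.comp (X - C 1) = f) : f = C (f.eval 0) := by
  have key : ∀ n : ℕ, f.eval (n : ℂ) = f.eval 0 := by
    intro n
    induction n with
    | zero => simp
    | succ n ih =>
      rw [← ih]
      conv_lhs => rw [← h]
      simp [eval_comp]
  refine eq_of_infinite_eval_eq _ _ (Set.Infinite.mono ?_ (Set.infinite_range_of_injective
    (Nat.cast_injective (R := ℂ))))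
  rintro _ ⟨n, rfl⟩
  simp [key n]

theorem shift_ker (K : Polynomial ℂ → Prop) (hsub : ∀ f g, K f → K g → K (f - g))
    (hsh : ∀ f, K f → K (f.comp (X - C 1))) (hC : ∀ c, K (C c) → c = 0) :
    ∀ (n : ℕ) (f : Polynomial ℂ), f.natDegree = n → K f → f = 0 := by
  intro n
  induction n using Nat.strong_induction_on with
  | _ n ih =>
    intro f hn hf
    by_contra hf0
    have hg := hsub _ _ hf (hsh f hf)
    have hconst : f.natDegree = 0 → False := by
      intro h0
      rw [eq_C_of_natDegree_eq_zero h0] at hf hf0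
      exact hf0 (by rw [hC _ hf, C_0])
    have hg0 : f - f.comp (X - C 1) = 0 := by
      by_contra hne
      refine hne (ih _ ?_ _ rfl hg)
      rw [← hn]
      apply natDegree_lt_natDegree hne
      have hlc : (f.comp (X - C 1)).leadingCoeff = f.leadingCoeff := by
        rw [leadingCoeff_comp (by rw [natDegree_X_sub_C]; exact one_ne_zero), leadingCoeff_X_sub_C,
          one_pow, mul_one]
      refine degree_sub_lt_left ?_ hf0 hlc.symm
      have h1 : f.comp (X - C 1) ≠ 0 := by
        rw [← leadingCoeff_ne_zero, hlc]; exact leadingCoeff_ne_zero.mpr hf0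
      rw [degree_eq_natDegree hf0, degree_eq_natDegree h1, natDegree_comp,
        natDegree_X_sub_C, mul_one]
    have := const_of_shift f (sub_eq_zero.mp hg0).symm
    exact hconst (by rw [this]; simp)

/-- Lemma 3 of the paper: a nonzero irreducible `𝒦`-module
`(V, T, P)` on which `ℂ[t,t⁻¹]` is torsion (some nonzero polynomial in `T`
kills a nonzero vector) is isomorphic to `Ω(λ)` for some `λ ≠ 0`, i.e. to
`ℂ[x]` with `t` acting by `f(x) ↦ λ·f(x−1)` and `∂` by multiplication by `x`. -/
theorem stmt13 (V : Type*) [AddCommGroup V] [Module ℂ V] [Nontrivial V]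
    (T : V ≃ₗ[ℂ] V) (P : V →ₗ[ℂ] V)
    (hcomm : P ∘ₗ (T : V →ₗ[ℂ] V) - (T : V →ₗ[ℂ] V) ∘ₗ P = (T : V →ₗ[ℂ] V))
    (hirr : ∀ W : Submodule ℂ V, (∀ v ∈ W, T v ∈ W) → (∀ v ∈ W, T.symm v ∈ W) →
      (∀ v ∈ W, P v ∈ W) → W = ⊥ ∨ W = ⊤)
    (htor : ∃ (v : V) (q : Polynomial ℂ), v ≠ 0 ∧ q ≠ 0 ∧
      (Polynomial.aeval ((T : V →ₗ[ℂ] V) : Module.End ℂ V) q) v = 0) :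
    ∃ (l : ℂ) (φ : V ≃ₗ[ℂ] Polynomial ℂ), l ≠ 0 ∧
      (∀ u : V, φ (T u) = l • (φ u).comp (Polynomial.X - Polynomial.C 1)) ∧
      (∀ u : V, φ (P u) = Polynomial.X * φ u) := by
  obtain ⟨v, q, hv, hq, hqv⟩ := htor
  obtain ⟨l, w, hw, hTw⟩ := exists_eigvec _ _ q v rfl hq hv hqv
  replace hTw : T w = l • w := hTw
  have hl : l ≠ 0 := by
    rintro rfl
    rw [zero_smul] at hTw
    exact hw (T.map_eq_zero_iff.mp hTw)
  have hTP : ∀ u, T (P u) = P (T u) - T u := by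
    intro u
    have h := LinearMap.congr_fun hcomm u
    simp only [LinearMap.sub_apply, LinearMap.comp_apply, LinearEquiv.coe_coe] at h
    exact eq_sub_of_add_eq' (sub_eq_iff_eq_add.mp h).symm
  let ψ : Polynomial ℂ →ₗ[ℂ] V :=
    (LinearMap.applyₗ w).comp (aeval (R := ℂ) (A := Module.End ℂ V) P).toLinearMap
  have hψ : ∀ f, ψ f = aeval (R := ℂ) (A := Module.End ℂ V) P f w := fun f => rfl
  have hψX : ∀ f, ψ (X * f) = P (ψ f) := by
    intro f
    rw [hψ, hψ, map_mul, aeval_X, Module.End.mul_apply]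
  have hψC : ∀ c, ψ (C c) = c • w := by
    intro c
    rw [hψ, aeval_C, Module.algebraMap_end_apply]
  have hψT : ∀ f, T (ψ f) = ψ (l • f.comp (X - C 1)) := by
    intro f
    induction f using Polynomial.induction_on' with
    | add f g hf hg => rw [map_add, map_add, hf, hg, add_comp, smul_add, map_add]
    | monomial n a =>
      induction n with
      | zero =>
        rw [monomial_zero_left, hψC, C_comp, map_smul, map_smul, hTw, hψC, smul_comm]
      | succ n ih =>
        have : monomial (n+1) a = X * monomial n a := by rw [X_mul_monomial]
        rw [this, hψX, hTP, ih, ← hψX, ← map_sub, mul_comp, X_comp]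
        congr 1
        rw [mul_smul_comm, ← smul_sub, sub_mul, C_1, one_mul]
  have hinj : ∀ f, ψ f = 0 → f = 0 := by
    intro f hf
    refine shift_ker (fun f => ψ f = 0) ?_ ?_ ?_ _ f rfl hf
    · intro f g hf hg
      rw [map_sub, hf, hg, sub_zero]
    · intro f hf
      have h := hψT f
      rw [hf, map_zero, map_smul] at h
      exact (smul_eq_zero.mp h.symm).resolve_left hl
    · intro c hc
      rw [hψC] at hc
      exact (smul_eq_zero.mp hc).resolve_right hw
  have hsurj : LinearMap.range ψ = ⊤ := by
    refine (hirr (LinearMap.range ψ) ?_ ?_ ?_).resolve_left ?_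
    · rintro _ ⟨f, rfl⟩
      exact ⟨_, (hψT f).symm⟩
    · rintro _ ⟨f, rfl⟩
      refine ⟨l⁻¹ • f.comp (X + C 1), ?_⟩
      rw [LinearEquiv.eq_symm_apply, hψT]
      congr 1
      rw [smul_comp, smul_smul, mul_inv_cancel₀ hl, one_smul, comp_assoc]
      simp
    · rintro _ ⟨f, rfl⟩
      exact ⟨_, hψX f⟩
    · intro h
      have : w ∈ LinearMap.range ψ := ⟨C 1, by rw [hψC, one_smul]⟩
      rw [h] at this
      exact hw ((Submodule.mem_bot ℂ).mp this)
  let e : Polynomial ℂ ≃ₗ[ℂ] V := LinearEquiv.ofBijective ψ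
    ⟨(injective_iff_map_eq_zero ψ).mpr hinj, LinearMap.range_eq_top.mp hsurj⟩
  have he : ∀ f, e f = ψ f := fun f => rfl
  refine ⟨l, e.symm, hl, ?_, ?_⟩
  · intro u
    obtain ⟨f, rfl⟩ := e.surjective u
    rw [LinearEquiv.symm_apply_eq, LinearEquiv.symm_apply_apply, he, he, hψT]
  · intro u
    obtain ⟨f, rfl⟩ := e.surjective u
    rw [LinearEquiv.symm_apply_eq, LinearEquiv.symm_apply_apply, he, he, hψX]
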